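/- arXiv:2605.21761 — 2 statements merged into one kernel-verified Lean document; each statement's English description precedes it below -/
import Mathlib

section
/- Let φ be a circle covering map of degree two with φ(0) = 0. Then the Thompson group T_φ admits no finite orbit: for every x ∈ 𝕊¹ the set {g(x) : g ∈ T_φ} is infinite. -/
open Set Filter MeasureTheory Topology

noncomputable section

/-- `F : ℝ → ℝ` is a lift of `φ : 𝕊¹ → 𝕊¹` witnessing that `φ` is a
circle covering map of degree two. -/
def IsLiftDeg2 (φ : UnitAddCircle → UnitAddCircle) (F : ℝ → ℝ) : Prop :=
  Continuous F ∧ StrictMono F ∧ (∀ x : ℝ, F (x + 1) = F x + 2) ∧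
    ∀ x : ℝ, φ (x : UnitAddCircle) = ((F x : ℝ) : UnitAddCircle)

/-- The closed arc on the circle starting at `a` (counterclockwise) of length `ℓ`. -/
def closedArc (a ℓ : ℝ) : Set UnitAddCircle :=
  (fun t : ℝ => (t : UnitAddCircle)) '' Set.Icc a (a + ℓ)

/-- The open arc on the circle starting at `a` (counterclockwise) of length `ℓ`. -/
def openArc (a ℓ : ℝ) : Set UnitAddCircle :=
  (fun t : ℝ => (t : UnitAddCircle)) '' Set.Ioo a (a + ℓ)

/-- The open arc `(x, x + ε)` counterclockwise. -/
def rightArc (x : UnitAddCircle) (ε : ℝ) : Set UnitAddCircle :=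
  {y | ∃ t : ℝ, 0 < t ∧ t < ε ∧ y = x + (t : UnitAddCircle)}

/-- The open arc `(x - ε, x)` counterclockwise. -/
def leftArc (x : UnitAddCircle) (ε : ℝ) : Set UnitAddCircle :=
  {y | ∃ t : ℝ, 0 < t ∧ t < ε ∧ y = x - (t : UnitAddCircle)}

/-- `I` is a periodic interval of `φ` of period `s`: a proper nondegenerate closed arc
mapped onto itself homeomorphically by `φ^s`. -/
def IsPeriodicInterval (φ : UnitAddCircle → UnitAddCircle) (s : ℕ)
    (I : Set UnitAddCircle) : Prop :=
  1 ≤ s ∧ (∃ a ℓ : ℝ, 0 < ℓ ∧ ℓ < 1 ∧ I = closedArc a ℓ) ∧ Set.BijOn (φ^[s]) I I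

/-- A maximal periodic interval of `φ`. -/
def IsMaxPeriodicInterval (φ : UnitAddCircle → UnitAddCircle)
    (I : Set UnitAddCircle) : Prop :=
  (∃ s, IsPeriodicInterval φ s I) ∧ ∀ J, (∃ s, IsPeriodicInterval φ s J) → I ⊆ J → I = J

/-- `Λ = 𝕊¹ \ ⋃ₙ φ⁻ⁿ(I₁ ∪ ⋯ ∪ I_r)`, the complement of all preimages of the
maximal periodic intervals. -/
def lambdaSet (φ : UnitAddCircle → UnitAddCircle) : Set UnitAddCircle :=
  Set.univ \ ⋃ n : ℕ, (φ^[n]) ⁻¹' (⋃ I ∈ {I | IsMaxPeriodicInterval φ I}, I)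

/-- The doubling map `x ↦ 2x (mod 1)`. -/
def doubling : UnitAddCircle → UnitAddCircle := fun x => x + x

/-- `φ` is topologically conjugate to the doubling map. -/
def ConjugateToDoubling (φ : UnitAddCircle → UnitAddCircle) : Prop :=
  ∃ h : UnitAddCircle ≃ₜ UnitAddCircle, ∀ x, h (φ x) = doubling (h x)

/-- `I` is a `φ`-dyadic interval of degree `n` (described via the lift `F` of `φ`):
a closed arc whose endpoints are consecutive `φⁿ`-preimages of `0`. -/
def IsDyadic (F : ℝ → ℝ) (n : ℕ) (I : Set UnitAddCircle) : Prop :=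
  ∃ a b : ℝ, a < b ∧ (∃ k : ℤ, F^[n] a = (k : ℝ)) ∧ F^[n] b = F^[n] a + 1 ∧
    I = (fun t : ℝ => (t : UnitAddCircle)) '' Set.Icc a b

/-- `G` is a lift of the orientation-preserving circle homeomorphism `g`. -/
def IsOPLift (g : UnitAddCircle → UnitAddCircle) (G : ℝ → ℝ) : Prop :=
  Continuous G ∧ StrictMono G ∧ (∀ x : ℝ, G (x + 1) = G x + 1) ∧
    ∀ x : ℝ, g (x : UnitAddCircle) = ((G x : ℝ) : UnitAddCircle)

/-- `g` belongs to the Ghys–Sergiescu Thompson group `T_φ` (with `F` a lift of `φ`):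
`g` is an orientation-preserving circle homeomorphism and there are partitions of the
circle into `φ`-dyadic intervals `I k`, `J k` such that `g` maps `I k` onto `J k` and
`g = φ_{J k}⁻¹ ∘ φ_{I k}` on `I k`, i.e. `φ^[m k] ∘ g = φ^[n k]` on `I k`. -/
def InThompsonGroup (φ : UnitAddCircle → UnitAddCircle) (F : ℝ → ℝ)
    (g : UnitAddCircle → UnitAddCircle) : Prop :=
  (∃ G : ℝ → ℝ, IsOPLift g G) ∧
  ∃ (r : ℕ) (I J : Fin r → Set UnitAddCircle) (n m : Fin r → ℕ),
    0 < r ∧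
    (∀ k, IsDyadic F (n k) (I k)) ∧ (∀ k, IsDyadic F (m k) (J k)) ∧
    (⋃ k, I k) = Set.univ ∧ (⋃ k, J k) = Set.univ ∧
    (Pairwise fun k l => interior (I k) ∩ interior (I l) = ∅) ∧
    (Pairwise fun k l => interior (J k) ∩ interior (J l) = ∅) ∧
    (∀ k, g '' I k = J k) ∧ (∀ k, ∀ x ∈ I k, φ^[m k] (g x) = φ^[n k] x)

/-- `x` is a nonexpandable point for the action of `T_φ`: `g′(x) ≤ 1` for every
`g ∈ T_φ` (derivatives are computed via lifts). -/
def NonExpandable (φ : UnitAddCircle → UnitAddCircle) (F : ℝ → ℝ)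
    (x : UnitAddCircle) : Prop :=
  ∀ g G, InThompsonGroup φ F g → IsOPLift g G →
    ∀ x' : ℝ, (x' : UnitAddCircle) = x → deriv G x' ≤ 1

/-- `I` is nice for `φ`: no forward iterate of the boundary returns to the interior. -/
def IsNice (φ : UnitAddCircle → UnitAddCircle) (I : Set UnitAddCircle) : Prop :=
  ∀ n : ℕ, 1 ≤ n → (φ^[n]) '' (frontier I) ∩ interior I = ∅

/-- A nice interval: a proper nondegenerate closed arc that is nice. -/
def IsNiceInterval (φ : UnitAddCircle → UnitAddCircle) (I : Set UnitAddCircle) : Prop :=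
  (∃ a ℓ : ℝ, 0 < ℓ ∧ ℓ < 1 ∧ I = closedArc a ℓ) ∧ IsNice φ I

/-- `J` is a connected component of `S`. -/
def IsComponentOf (J S : Set UnitAddCircle) : Prop :=
  ∃ x ∈ S, J = connectedComponentIn S x

/-- The set of left endpoints of connected components of `𝕊¹ \ Λ`. -/
def leftEndpoints (Λ : Set UnitAddCircle) : Set UnitAddCircle :=
  {z | ∃ C : Set UnitAddCircle, IsComponentOf C (Set.univ \ Λ) ∧
    ∃ a ℓ : ℝ, 0 < ℓ ∧ ℓ ≤ 1 ∧ C = openArc a ℓ ∧ z = (a : UnitAddCircle)}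

/-- The set of right endpoints of connected components of `𝕊¹ \ Λ`. -/
def rightEndpoints (Λ : Set UnitAddCircle) : Set UnitAddCircle :=
  {z | ∃ C : Set UnitAddCircle, IsComponentOf C (Set.univ \ Λ) ∧
    ∃ a ℓ : ℝ, 0 < ℓ ∧ ℓ ≤ 1 ∧ C = openArc a ℓ ∧ z = ((a + ℓ : ℝ) : UnitAddCircle)}

/-- `x` is a parabolic periodic point of `φ`: `φ^s(x) = x` and `(φ^s)′(x) = 1`
(the derivative computed via the lift `F`). -/
def IsParabolicPeriodicPt (φ : UnitAddCircle → UnitAddCircle) (F : ℝ → ℝ)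
    (x : UnitAddCircle) : Prop :=
  ∃ s : ℕ, 1 ≤ s ∧ φ^[s] x = x ∧
    ∀ x' : ℝ, (x' : UnitAddCircle) = x → deriv (F^[s]) x' = 1

/-- The `n`-th iterate of a lift of `φ` is a lift of the `n`-th iterate of `φ`. -/
lemma IsLiftDeg2.iterate_coe {φ : UnitAddCircle → UnitAddCircle} {F : ℝ → ℝ}
    (hF : IsLiftDeg2 φ F) (n : ℕ) (x : ℝ) :
    φ^[n] (x : UnitAddCircle) = ((F^[n] x : ℝ) : UnitAddCircle) := by
  induction n generalizing x with
  | zero => rfl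
  | succ n ih => rw [Function.iterate_succ_apply, Function.iterate_succ_apply, hF.2.2.2, ih]

/-- A map that commutes with the unit translation up to the factor `D` commutes with all
integer translations up to the factor `D`. -/
lemma map_add_int_of_map_add_one {f : ℝ → ℝ} {D : ℝ} (hf : ∀ x, f (x + 1) = f x + D)
    (x : ℝ) (m : ℤ) : f (x + m) = f x + D * m := by
  induction m using Int.induction_on with
  | zero => simp
  | succ i ih => push_cast at ih ⊢; rw [← add_assoc, hf, ih]; ring
  | pred i ih =>
    have h := hf (x + ((-(i : ℤ) - 1 : ℤ) : ℝ))
    push_cast at ih h ⊢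
    rw [show x + (-(i : ℝ) - 1) + 1 = x + -(i : ℝ) by ring, ih] at h
    linarith

lemma IsLiftDeg2.surjective {φ : UnitAddCircle → UnitAddCircle} {F : ℝ → ℝ}
    (hF : IsLiftDeg2 φ F) : Function.Surjective F := by
  intro y
  obtain ⟨m, hm⟩ := exists_int_gt (|y| + |F 0|)
  have hadd := map_add_int_of_map_add_one hF.2.2.1 0
  have hpos := hadd m
  have hneg := hadd (-m)
  push_cast at hneg
  have := abs_le.mp (le_refl |y|)
  have := abs_le.mp (le_refl |F 0|)
  exact mem_range_of_exists_le_of_exists_ge hF.1 ⟨_, by rw [hneg]; linarith⟩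
    ⟨_, by rw [hpos]; linarith⟩

lemma IsLiftDeg2.iterate_add_one {φ : UnitAddCircle → UnitAddCircle} {F : ℝ → ℝ}
    (hF : IsLiftDeg2 φ F) (n : ℕ) (x : ℝ) : F^[n] (x + 1) = F^[n] x + (2 ^ n : ℕ) := by
  induction n with
  | zero => simp
  | succ n ih =>
    have h := map_add_int_of_map_add_one hF.2.2.1 (F^[n] x) (2 ^ n : ℕ)
    rw [Function.iterate_succ_apply', Function.iterate_succ_apply', ih]
    push_cast at h ⊢
    rw [h, pow_succ']

/-- The `n`-th iterate of a lift of a degree-two covering, as an order isomorphism of `ℝ`. -/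
def IsLiftDeg2.iterateIso {φ : UnitAddCircle → UnitAddCircle} {F : ℝ → ℝ}
    (hF : IsLiftDeg2 φ F) (n : ℕ) : ℝ ≃o ℝ :=
  StrictMono.orderIsoOfSurjective _ (hF.2.1.iterate n) (hF.surjective.iterate n)

/-- The arc of the circle that `H` maps onto `[c, c + 1]`. -/
def unitArc (H : ℝ ≃o ℝ) (c : ℤ) : Set UnitAddCircle :=
  (fun t : ℝ => (t : UnitAddCircle)) '' Set.Icc (H.symm c) (H.symm (c + 1))

lemma coe_mem_unitArc {H : ℝ ≃o ℝ} {c : ℤ} {t : ℝ} (h : (c : ℝ) ≤ H t) (h' : H t ≤ c + 1) :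
    (t : UnitAddCircle) ∈ unitArc H c :=
  ⟨t, ⟨H.symm_apply_le.mpr h, H.le_symm_apply.mpr h'⟩, rfl⟩

lemma exists_of_mem_unitArc {H : ℝ ≃o ℝ} {c : ℤ} {y : UnitAddCircle} (h : y ∈ unitArc H c) :
    ∃ t : ℝ, (c : ℝ) ≤ H t ∧ H t ≤ c + 1 ∧ (t : UnitAddCircle) = y := by
  obtain ⟨t, ht, rfl⟩ := h
  exact ⟨t, H.symm_apply_le.mp ht.1, H.le_symm_apply.mp ht.2, rfl⟩

lemma exists_int_of_coe_eq {s t : ℝ} (h : (s : UnitAddCircle) = t) : ∃ m : ℤ, t = s + m := by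
  have h' : ((t - s : ℝ) : UnitAddCircle) = 0 := by rw [AddCircle.coe_sub, h, sub_self]
  obtain ⟨m, hm⟩ := (AddCircle.coe_eq_zero_iff 1).mp h'
  exact ⟨m, by rw [zsmul_one] at hm; linarith⟩

lemma coe_add_intCast (x : ℝ) (m : ℤ) : ((x + m : ℝ) : UnitAddCircle) = x := by
  have h : ((m : ℝ) : UnitAddCircle) = 0 := (AddCircle.coe_eq_zero_iff 1).mpr ⟨m, zsmul_one m⟩
  rw [AddCircle.coe_add, h, add_zero]

lemma interior_unitArc_inter {H : ℝ ≃o ℝ} {D : ℕ} (hH : ∀ x, H (x + 1) = H x + D) {c d : ℤ}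
    (hcd : ¬ (D : ℤ) ∣ d - c) : interior (unitArc H c) ∩ interior (unitArc H d) = ∅ := by
  have hfin : (unitArc H c ∩ unitArc H d).Finite := by
    refine Set.Finite.subset (s := {(H.symm c : UnitAddCircle), (H.symm (c + 1) : UnitAddCircle)})
      (by simp) ?_
    rintro y ⟨hc, hd⟩
    obtain ⟨s, hs, hs', rfl⟩ := exists_of_mem_unitArc hc
    obtain ⟨t, ht, ht', hts⟩ := exists_of_mem_unitArc hd
    obtain ⟨m, rfl⟩ := exists_int_of_coe_eq hts.symm
    rw [map_add_int_of_map_add_one hH] at ht ht'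
    rcases hs.eq_or_lt with h | h
    · left; rw [h, H.symm_apply_apply]
    rcases hs'.eq_or_lt with h' | h'
    · right; rw [Set.mem_singleton_iff, ← h', H.symm_apply_apply]
    refine absurd ⟨m, ?_⟩ hcd
    have h₁ : (d : ℝ) < c + 1 + D * m := by linarith
    have h₂ : (c : ℝ) + D * m < d + 1 := by linarith
    have h₁' : d < c + 1 + D * m := by exact_mod_cast h₁
    have h₂' : c + D * m < d + 1 := by exact_mod_cast h₂
    omega
  have : Nontrivial UnitAddCircle := by
    refine ⟨((1 / 2 : ℝ) : UnitAddCircle), 0, fun h => ?_⟩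
    obtain ⟨m, hm⟩ := (AddCircle.coe_eq_zero_iff 1).mp h
    rw [zsmul_one] at hm
    have hm' : ((2 * m : ℤ) : ℝ) = (1 : ℤ) := by push_cast; linarith
    have := Int.cast_injective hm'
    omega
  rw [← interior_inter, interior_eq_empty_iff_dense_compl]
  rw [Set.compl_eq_univ_sdiff]
  exact dense_univ.sdiff_finite hfin

lemma iUnion_unitArc {H : ℝ ≃o ℝ} {D : ℕ} (hD : 0 < D) (hH : ∀ x, H (x + 1) = H x + D) (j : ℤ) :
    ⋃ k : Fin D, unitArc H (k + j) = Set.univ := by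
  refine Set.eq_univ_of_forall fun y => ?_
  obtain ⟨t, rfl⟩ := QuotientAddGroup.mk_surjective y
  obtain ⟨q, hq⟩ : ∃ q : ℤ, q = ⌊H t⌋ - j := ⟨_, rfl⟩
  have hD' : (0 : ℤ) < D := by exact_mod_cast hD
  have hnn := Int.emod_nonneg q hD'.ne'
  have hlt := Int.emod_lt_of_pos q hD'
  have hdiv := Int.emod_add_mul_ediv q D
  refine Set.mem_iUnion.mpr ⟨⟨(q % D).toNat, by omega⟩, ?_⟩
  have hcast : (((q % D).toNat : ℕ) : ℤ) = q % D := Int.toNat_of_nonneg hnn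
  have hval : H (t + (-(q / D) : ℤ)) = H t + D * (-(q / D) : ℤ) :=
    map_add_int_of_map_add_one hH _ _
  have hidx : q % D + j = ⌊H t⌋ + D * (-(q / D)) := by linarith
  have hidx' : ((q % D + j : ℤ) : ℝ) = ⌊H t⌋ + D * ((-(q / D) : ℤ) : ℝ) := by
    rw [hidx]; push_cast; ring
  change (t : UnitAddCircle) ∈ _
  rw [← coe_add_intCast t (-(q / D))]
  apply coe_mem_unitArc <;> simp only [hcast] <;> rw [hidx', hval]
  · linarith [Int.floor_le (H t)]
  · linarith [Int.lt_floor_add_one (H t)]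

/-- The conjugate by `H` of the translation by `j`. -/
def conjTranslation (H : ℝ ≃o ℝ) (j : ℤ) (x : ℝ) : ℝ := H.symm (H x + j)

lemma conjTranslation_add_one {H : ℝ ≃o ℝ} {D : ℕ} (hH : ∀ x, H (x + 1) = H x + D) (j : ℤ)
    (x : ℝ) : conjTranslation H j (x + 1) = conjTranslation H j x + 1 := by
  apply H.injective
  rw [hH, conjTranslation, conjTranslation, H.apply_symm_apply, H.apply_symm_apply, hH]
  ring

/-- The circle map induced by `conjTranslation H j`. -/
def circleRotation {H : ℝ ≃o ℝ} {D : ℕ} (hH : ∀ x, H (x + 1) = H x + D) (j : ℤ) :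
    UnitAddCircle → UnitAddCircle :=
  Function.Periodic.lift (f := fun x : ℝ => (conjTranslation H j x : UnitAddCircle)) (c := 1)
    fun x => by
      change ((_ : ℝ) : UnitAddCircle) = _
      rw [conjTranslation_add_one hH, AddCircle.coe_add, AddCircle.coe_period, add_zero]

lemma circleRotation_coe {H : ℝ ≃o ℝ} {D : ℕ} (hH : ∀ x, H (x + 1) = H x + D) (j : ℤ) (x : ℝ) :
    circleRotation hH j x = (conjTranslation H j x : UnitAddCircle) := rfl

lemma isOPLift_circleRotation {H : ℝ ≃o ℝ} {D : ℕ} (hH : ∀ x, H (x + 1) = H x + D) (j : ℤ) :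
    IsOPLift (circleRotation hH j) (conjTranslation H j) := by
  refine ⟨?_, ?_, conjTranslation_add_one hH j, circleRotation_coe hH j⟩
  · exact H.symm.continuous.comp (H.continuous.add continuous_const)
  · exact fun x y h => H.symm.strictMono (by simpa using h)

lemma image_circleRotation_unitArc {H : ℝ ≃o ℝ} {D : ℕ} (hH : ∀ x, H (x + 1) = H x + D)
    (j c : ℤ) : circleRotation hH j '' unitArc H c = unitArc H (c + j) := by
  ext y
  constructor
  · rintro ⟨x, hx, rfl⟩
    obtain ⟨t, ht, ht', rfl⟩ := exists_of_mem_unitArc hx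
    rw [circleRotation_coe]
    apply coe_mem_unitArc <;> rw [conjTranslation, H.apply_symm_apply] <;> push_cast <;> linarith
  · intro hy
    obtain ⟨t, ht, ht', rfl⟩ := exists_of_mem_unitArc hy
    push_cast at ht ht'
    refine ⟨(H.symm (H t - j) : ℝ), ?_, ?_⟩
    · apply coe_mem_unitArc <;> rw [H.apply_symm_apply] <;> linarith
    · rw [circleRotation_coe, conjTranslation, H.apply_symm_apply, sub_add_cancel,
        H.symm_apply_apply]

lemma circleRotation_injOn {H : ℝ ≃o ℝ} {D : ℕ} (hH : ∀ x, H (x + 1) = H x + D)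
    (x : UnitAddCircle) : Set.InjOn (fun j : ℕ => circleRotation hH j x) (Set.Iio D) := by
  obtain ⟨t, rfl⟩ := QuotientAddGroup.mk_surjective x
  intro i hi j hj hij
  obtain ⟨m, hm⟩ := exists_int_of_coe_eq (s := conjTranslation H i t) (t := conjTranslation H j t)
    hij
  have h := congrArg H hm
  rw [map_add_int_of_map_add_one hH, conjTranslation, conjTranslation, H.apply_symm_apply,
    H.apply_symm_apply] at h
  have h' : (j : ℤ) - i = D * m := by
    have : (j : ℝ) - i = D * m := by push_cast at h; linarith
    exact_mod_cast this
  have hdvd : (i : ℤ) ≡ j [ZMOD D] := Int.modEq_iff_dvd.mpr ⟨m, h'⟩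
  exact Nat.ModEq.eq_of_lt_of_lt (Int.natCast_modEq_iff.mp hdvd) hi hj

lemma IsLiftDeg2.iterateIso_add_one {φ : UnitAddCircle → UnitAddCircle} {F : ℝ → ℝ}
    (hF : IsLiftDeg2 φ F) (n : ℕ) (x : ℝ) :
    hF.iterateIso n (x + 1) = hF.iterateIso n x + (2 ^ n : ℕ) :=
  hF.iterate_add_one n x

lemma IsLiftDeg2.isDyadic_unitArc {φ : UnitAddCircle → UnitAddCircle} {F : ℝ → ℝ}
    (hF : IsLiftDeg2 φ F) (n : ℕ) (c : ℤ) : IsDyadic F n (unitArc (hF.iterateIso n) c) := by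
  have h (y : ℝ) : F^[n] ((hF.iterateIso n).symm y) = y := (hF.iterateIso n).apply_symm_apply y
  exact ⟨_, _, (hF.iterateIso n).symm.strictMono (lt_add_one _), ⟨c, h _⟩, by rw [h, h], rfl⟩

lemma IsLiftDeg2.inThompsonGroup_circleRotation {φ : UnitAddCircle → UnitAddCircle} {F : ℝ → ℝ}
    (hF : IsLiftDeg2 φ F) (n : ℕ) (j : ℤ) :
    InThompsonGroup φ F (circleRotation (hF.iterateIso_add_one n) j) := by
  have hH := hF.iterateIso_add_one n
  have hdvd (i : ℤ) {k l : Fin (2 ^ n)} (hkl : k ≠ l) :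
      ¬ ((2 ^ n : ℕ) : ℤ) ∣ ((l : ℤ) + i) - (k + i) := by
    rw [add_sub_add_right_eq_sub]
    intro h
    exact hkl (Fin.ext (Nat.ModEq.eq_of_lt_of_lt
      (Int.natCast_modEq_iff.mp (Int.modEq_iff_dvd.mpr h)) k.2 l.2))
  refine ⟨⟨_, isOPLift_circleRotation hH j⟩, 2 ^ n,
    fun k => unitArc (hF.iterateIso n) (k + 0), fun k => unitArc (hF.iterateIso n) (k + j),
    fun _ => n, fun _ => n, by positivity, fun k => hF.isDyadic_unitArc n _,
    fun k => hF.isDyadic_unitArc n _, iUnion_unitArc (by positivity) hH 0,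
    iUnion_unitArc (by positivity) hH j, fun k l hkl => interior_unitArc_inter hH (hdvd 0 hkl),
    fun k l hkl => interior_unitArc_inter hH (hdvd j hkl),
    fun k => by simp only [add_zero, image_circleRotation_unitArc], ?_⟩
  intro _ x _
  obtain ⟨t, rfl⟩ := QuotientAddGroup.mk_surjective x
  change φ^[n] (conjTranslation (hF.iterateIso n) j t : UnitAddCircle) = φ^[n] (t : UnitAddCircle)
  have h : F^[n] (conjTranslation (hF.iterateIso n) j t) = F^[n] t + j :=
    (hF.iterateIso n).apply_symm_apply _
  rw [hF.iterate_coe, hF.iterate_coe, h, coe_add_intCast]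

/-- the Thompson group `T_φ` admits no finite orbit. -/
theorem thompson_no_finite_orbit
    (φ : UnitAddCircle → UnitAddCircle) (F : ℝ → ℝ)
    (hF : IsLiftDeg2 φ F) (h0 : φ 0 = 0) :
    ∀ x : UnitAddCircle, {y | ∃ g, InThompsonGroup φ F g ∧ y = g x}.Infinite := by
  intro x hfin
  let N := hfin.toFinset.card
  have hcard := Finset.card_le_card_of_injOn (s := Finset.range (2 ^ N)) (t := hfin.toFinset)
    (fun j => circleRotation (hF.iterateIso_add_one N) j x)
    (fun j _ => by
      simpa using ⟨_, hF.inThompsonGroup_circleRotation N j, rfl⟩)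
    (by simpa using circleRotation_injOn (hF.iterateIso_add_one N) x)
  rw [Finset.card_range] at hcard
  exact absurd hcard (not_le.mpr Nat.lt_two_pow_self)
end
end

section
/- Let φ be a circle covering map of degree two with φ(0) = 0. Then for every x ∈ 𝕊¹ and every k ≥ 1 there exist g ∈ T_φ and an open neighborhood U of x such that g(y) = φ^k(y) for all y ∈ U. -/
open Set Filter MeasureTheory Topology

noncomputable section

/-! ### Iterates of the lift -/

namespace IsLiftDeg2

variable {φ : UnitAddCircle → UnitAddCircle} {F : ℝ → ℝ}

lemma map_add_intCast (hF : IsLiftDeg2 φ F) (x : ℝ) (m : ℤ) : F (x + m) = F x + 2 * m := by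
  obtain ⟨-, -, hper, -⟩ := hF
  induction m with
  | zero => simp
  | succ i ih =>
    have h := hper (x + (i : ℤ))
    push_cast at h ih ⊢
    rw [← add_assoc, h, ih]
    ring
  | pred i ih =>
    have h := hper (x + (-(i : ℤ) - 1 : ℤ))
    push_cast at h ih ⊢
    rw [show x + (-(i : ℝ) - 1) + 1 = x + -(i : ℝ) by ring, ih] at h
    linarith

lemma iterate_add_intCast (hF : IsLiftDeg2 φ F) (n : ℕ) (x : ℝ) (m : ℤ) :
    F^[n] (x + m) = F^[n] x + 2 ^ n * m := by
  induction n with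
  | zero => simp
  | succ n ih =>
    rw [Function.iterate_succ_apply', Function.iterate_succ_apply', ih]
    have h := hF.map_add_intCast (F^[n] x) (2 ^ n * m)
    push_cast at h
    rw [h]
    ring

lemma iterate_add_one_s18 (hF : IsLiftDeg2 φ F) (n : ℕ) (x : ℝ) :
    F^[n] (x + 1) = F^[n] x + 2 ^ n := by
  simpa using hF.iterate_add_intCast n x 1

lemma surjective_s18 (hF : IsLiftDeg2 φ F) : Function.Surjective F := by
  intro y
  obtain ⟨m, hm⟩ := exists_int_gt |y - F 0|
  have hm' := abs_lt.1 hm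
  have hpos : (0 : ℝ) ≤ m := (abs_nonneg _).trans hm.le
  have h₁ := hF.map_add_intCast 0 m
  have h₂ := hF.map_add_intCast 0 (-m)
  push_cast at h₂
  rw [zero_add] at h₁ h₂
  obtain ⟨x, -, hx⟩ := intermediate_value_Icc (by linarith : -(m : ℝ) ≤ m) hF.1.continuousOn
    (show y ∈ Icc (F (-m)) (F m) from ⟨by linarith, by linarith⟩)
  exact ⟨x, hx⟩

lemma strictMono_iterate (hF : IsLiftDeg2 φ F) (n : ℕ) : StrictMono F^[n] :=
  hF.2.1.iterate n

lemma surjective_iterate (hF : IsLiftDeg2 φ F) (n : ℕ) : Function.Surjective F^[n] :=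
  hF.surjective_s18.iterate n

lemma iterate_coe_s18 (hF : IsLiftDeg2 φ F) (n : ℕ) (x : ℝ) :
    φ^[n] (x : UnitAddCircle) = ((F^[n] x : ℝ) : UnitAddCircle) := by
  induction n with
  | zero => rfl
  | succ n ih =>
    rw [Function.iterate_succ_apply', Function.iterate_succ_apply', ih, hF.2.2.2]

lemma exists_map_intCast (hF : IsLiftDeg2 φ F) (h0 : φ 0 = 0) (m : ℤ) :
    ∃ l : ℤ, F m = l := by
  have h : ((F 0 : ℝ) : UnitAddCircle) = 0 := by
    rw [← hF.2.2.2, AddCircle.coe_zero, h0]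
  obtain ⟨l, hl⟩ := (AddCircle.coe_eq_zero_iff (1 : ℝ)).1 h
  refine ⟨l + 2 * m, ?_⟩
  have h₁ := hF.map_add_intCast 0 m
  rw [zero_add] at h₁
  rw [h₁, ← hl]
  simp

end IsLiftDeg2

/-! ### Chains of dyadic segments -/

/-- The segment `[p, q]` projects to a dyadic interval of degree `n`. -/
def IsDyadicSegment (F : ℝ → ℝ) (n : ℕ) (p q : ℝ) : Prop :=
  (∃ k : ℤ, F^[n] p = k) ∧ F^[n] q = F^[n] p + 1

/-- `c 0, …, c R` are consecutive endpoints of dyadic segments of degrees `m 0, …, m (R - 1)`. -/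
def IsDyadicChain (F : ℝ → ℝ) (R : ℕ) (c : ℕ → ℝ) (m : ℕ → ℕ) : Prop :=
  ∀ i < R, IsDyadicSegment F (m i) (c i) (c (i + 1))

/-- The sequence `a, c 0, c 1, …`. -/
def prependSeq {α : Type*} (a : α) (c : ℕ → α) : ℕ → α
  | 0 => a
  | i + 1 => c i

section Thompson

variable {φ : UnitAddCircle → UnitAddCircle} {F : ℝ → ℝ}

lemma IsDyadicSegment.lt (hF : IsLiftDeg2 φ F) {n : ℕ} {p q : ℝ}
    (h : IsDyadicSegment F n p q) : p < q :=
  (hF.strictMono_iterate n).lt_iff_lt.1 (by rw [h.2]; linarith)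

lemma IsDyadicSegment.exists_split (hF : IsLiftDeg2 φ F) (h0 : φ 0 = 0) {n : ℕ} {p q : ℝ}
    (h : IsDyadicSegment F n p q) :
    ∃ r, IsDyadicSegment F (n + 1) p r ∧ IsDyadicSegment F (n + 1) r q := by
  obtain ⟨⟨k, hk⟩, hq⟩ := h
  obtain ⟨l, hl⟩ := hF.exists_map_intCast h0 k
  obtain ⟨r, hr⟩ := hF.surjective_iterate (n + 1) (l + 1)
  have hp : F^[n + 1] p = l := by rw [Function.iterate_succ_apply', hk, hl]
  have hq' : F^[n + 1] q = l + 2 := by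
    rw [Function.iterate_succ_apply', hq, hF.2.2.1, hk, hl]
  refine ⟨r, ⟨⟨l, hp⟩, by rw [hr, hp]⟩, ⟨l + 1, by rw [hr]; push_cast; rfl⟩, ?_⟩
  rw [hr, hq']
  ring

lemma IsDyadicSegment.isDyadic (hF : IsLiftDeg2 φ F) {n : ℕ} {p q : ℝ}
    (h : IsDyadicSegment F n p q) :
    IsDyadic F n ((fun t : ℝ => (t : UnitAddCircle)) '' Icc p q) :=
  ⟨p, q, h.lt hF, h.1, h.2, rfl⟩

lemma IsDyadicChain.prepend {R n : ℕ} {p : ℝ} {c : ℕ → ℝ} {m : ℕ → ℕ}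
    (hc : IsDyadicChain F R c m) (hp : IsDyadicSegment F n p (c 0)) :
    IsDyadicChain F (R + 1) (prependSeq p c) (prependSeq n m) := by
  rintro (_ | i) hi
  · exact hp
  · exact hc i (by omega)

/-- A dyadic segment can be subdivided into any positive number of dyadic segments. -/
lemma IsDyadicSegment.exists_chain (hF : IsLiftDeg2 φ F) (h0 : φ 0 = 0) (M : ℕ) {n : ℕ} {p q : ℝ}
    (h : IsDyadicSegment F n p q) :
    ∃ c m, c 0 = p ∧ c (M + 1) = q ∧ IsDyadicChain F (M + 1) c m := by
  induction M generalizing n p with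
  | zero =>
    refine ⟨prependSeq p fun _ => q, fun _ => n, rfl, rfl, fun i hi => ?_⟩
    obtain rfl : i = 0 := by omega
    exact h
  | succ M ih =>
    obtain ⟨r, hpr, hrq⟩ := h.exists_split hF h0
    obtain ⟨c, m, rfl, rfl, hc⟩ := ih hrq
    exact ⟨prependSeq p c, prependSeq (n + 1) m, rfl, rfl, hc.prepend hpr⟩

lemma IsDyadicChain.strictMonoOn (hF : IsLiftDeg2 φ F) {R : ℕ} {c : ℕ → ℝ} {m : ℕ → ℕ}
    (hc : IsDyadicChain F R c m) : StrictMonoOn c (Iic R) :=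
  strictMonoOn_Iic_of_lt_succ fun i hi => (hc i hi).lt hF

/-! ### Partitions of the circle -/

lemma iUnion_coe_image_Icc {R : ℕ} {c : ℕ → ℝ} (hR : c R = c 0 + 1) :
    (⋃ i : Fin R, (fun t : ℝ => (t : UnitAddCircle)) '' Icc (c i) (c (i + 1))) = univ := by
  refine eq_univ_of_forall fun y => ?_
  obtain ⟨t, ht, rfl⟩ : ∃ t ∈ Ico (c 0) (c 0 + 1), (t : UnitAddCircle) = y := by
    have h := AddCircle.coe_image_Ico_eq (1 : ℝ) (c 0)
    exact (h ▸ mem_univ y : y ∈ _ '' _)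
  rw [← hR] at ht
  have key : ∀ n, t < c n → ∃ i < n, t ∈ Icc (c i) (c (i + 1)) := by
    intro n hn
    induction n with
    | zero => exact absurd ht.1 (not_le.2 hn)
    | succ n ih =>
      rcases lt_or_ge t (c n) with h | h
      · obtain ⟨i, hi, hti⟩ := ih h
        exact ⟨i, by omega, hti⟩
      · exact ⟨n, by omega, h, hn.le⟩
  obtain ⟨i, hi, hti⟩ := key R ht.2
  exact mem_iUnion.2 ⟨⟨i, hi⟩, t, hti, rfl⟩

lemma UnitAddCircle.coe_eq_coe_iff {s t : ℝ} :
    (s : UnitAddCircle) = (t : UnitAddCircle) ↔ ∃ n : ℤ, t = s + n := by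
  rw [eq_comm, ← sub_eq_zero, ← AddCircle.coe_sub, AddCircle.coe_eq_zero_iff]
  refine exists_congr fun n => ?_
  rw [zsmul_one, eq_sub_iff_add_eq, eq_comm, add_comm]

lemma interior_inter_interior_coe_image_Icc {p q p' q' : ℝ} (h₁ : q ≤ p') (h₂ : q' ≤ p + 1) :
    interior ((fun t : ℝ => (t : UnitAddCircle)) '' Icc p q) ∩
      interior ((fun t : ℝ => (t : UnitAddCircle)) '' Icc p' q') = ∅ := by
  rw [← interior_inter, eq_empty_iff_forall_notMem]
  intro y hy
  obtain ⟨t₀, rfl⟩ := QuotientAddGroup.mk_surjective y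
  have hopen : IsOpen ((fun t : ℝ => (t : UnitAddCircle)) ⁻¹'
      interior ((fun t : ℝ => (t : UnitAddCircle)) '' Icc p q ∩
        (fun t : ℝ => (t : UnitAddCircle)) '' Icc p' q')) :=
    isOpen_interior.preimage (AddCircle.continuous_mk' 1)
  have hcount : (range (fun n : ℤ => p' + n) ∪ range (fun n : ℤ => q' + n)).Countable :=
    (countable_range _).union (countable_range _)
  obtain ⟨t, ht, htc⟩ := (hcount.dense_compl ℝ).inter_open_nonempty _ hopen ⟨t₀, hy⟩
  obtain ⟨⟨u, hu, hut⟩, ⟨v, hv, hvt⟩⟩ := interior_subset ht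
  obtain ⟨n, rfl⟩ := UnitAddCircle.coe_eq_coe_iff.1 hvt
  obtain ⟨l, hl⟩ := UnitAddCircle.coe_eq_coe_iff.1 (hut.trans hvt.symm)
  refine htc ?_
  rcases le_or_gt l 0 with h | h
  · have : (l : ℝ) ≤ 0 := by exact_mod_cast h
    left
    exact ⟨n, by have := hu.2; have := hv.1; simp only; linarith⟩
  · have : (1 : ℝ) ≤ l := by exact_mod_cast h
    right
    exact ⟨n, by have := hu.1; have := hv.2; simp only; linarith⟩

lemma pairwise_interior_coe_image_Icc {R : ℕ} {c : ℕ → ℝ} (hc : StrictMonoOn c (Iic R))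
    (hR : c R = c 0 + 1) :
    Pairwise fun k l : Fin R =>
      interior ((fun t : ℝ => (t : UnitAddCircle)) '' Icc (c k) (c (k + 1))) ∩
        interior ((fun t : ℝ => (t : UnitAddCircle)) '' Icc (c l) (c (l + 1))) = ∅ := by
  have key : ∀ k l : Fin R, k < l →
      interior ((fun t : ℝ => (t : UnitAddCircle)) '' Icc (c k) (c (k + 1))) ∩
        interior ((fun t : ℝ => (t : UnitAddCircle)) '' Icc (c l) (c (l + 1))) = ∅ := by
    intro k l hkl
    have hkl' : (k : ℕ) < l := hkl
    have hl := l.2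
    have mono : ∀ i j : ℕ, i ≤ j → j ≤ R → c i ≤ c j := fun i j hij hj =>
      hc.monotoneOn (mem_Iic.2 (hij.trans hj)) (mem_Iic.2 hj) hij
    refine interior_inter_interior_coe_image_Icc (mono _ _ hkl' hl.le) ?_
    have := mono _ _ (show (l : ℕ) + 1 ≤ R from hl) le_rfl
    have := mono 0 k (Nat.zero_le _) (by omega)
    linarith
  intro k l hkl
  rcases lt_or_gt_of_ne hkl with h | h
  · exact key k l h
  · rw [inter_comm]
    exact key l k h

/-! ### Homeomorphisms matching two chains -/

/-- The increasing homeomorphism of the line that matches two dyadic segments. -/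
lemma exists_segment_map (hF : IsLiftDeg2 φ F) (n m : ℕ) (u v : ℝ) :
    ∃ h : ℝ → ℝ, Continuous h ∧ StrictMono h ∧ ∀ t, F^[m] (h t) = F^[n] t - u + v := by
  choose h hh using fun t => hF.surjective_iterate m (F^[n] t - u + v)
  have hmono : StrictMono h := fun s t hst => by
    rw [← (hF.strictMono_iterate m).lt_iff_lt, hh, hh]
    linarith [hF.strictMono_iterate n hst]
  refine ⟨h, hmono.monotone.continuous_of_surjective fun y => ?_, hmono, hh⟩
  obtain ⟨t, ht⟩ := hF.surjective_iterate n (F^[m] y - v + u)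
  refine ⟨t, (hF.strictMono_iterate m).injective ?_⟩
  rw [hh, ht]
  ring

/-- Gluing of the maps matching the corresponding segments of two chains. -/
lemma exists_chain_map (hF : IsLiftDeg2 φ F) {R : ℕ} {a b : ℕ → ℝ} {n m : ℕ → ℕ}
    (ha : IsDyadicChain F R a n) (hb : IsDyadicChain F R b m) :
    ∃ G : ℝ → ℝ, Continuous G ∧ StrictMono G ∧ (∀ i ≤ R, G (a i) = b i) ∧
      ∀ i < R, ∀ t ∈ Icc (a i) (a (i + 1)),
        F^[m i] (G t) = F^[n i] t - F^[n i] (a i) + F^[m i] (b i) := by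
  induction R with
  | zero =>
    refine ⟨fun t => t + (b 0 - a 0), by fun_prop, fun s t h => by simpa using h, ?_, by simp⟩
    intro i hi
    obtain rfl : i = 0 := by omega
    ring
  | succ R ih =>
    obtain ⟨G, hGc, hGm, hGab, hG⟩ :=
      ih (fun i hi => ha i (by omega)) (fun i hi => hb i (by omega))
    obtain ⟨h, hhc, hhm, hh⟩ :=
      exists_segment_map hF (n R) (m R) (F^[n R] (a R)) (F^[m R] (b R))
    have hinj := (hF.strictMono_iterate (m R)).injective
    have hhR : h (a R) = b R := hinj (by rw [hh]; ring)
    have hhR' : h (a (R + 1)) = b (R + 1) := hinj (by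
      rw [hh, (ha R (by omega)).2, (hb R (by omega)).2]; ring)
    have hGR := hGab R le_rfl
    have hle : ∀ i ≤ R, a i ≤ a R := fun i hi =>
      (ha.strictMonoOn hF).monotoneOn (mem_Iic.2 (by omega)) (mem_Iic.2 (by omega)) hi
    have hlt : a R < a (R + 1) := (ha R (by omega)).lt hF
    refine ⟨fun t => if t ≤ a R then G t else h t,
      hGc.if_le hhc continuous_id continuous_const ?_, ?_, ?_, ?_⟩
    · rintro t rfl
      rw [hGR, hhR]
    · intro s t hst
      simp only
      split_ifs with h₁ h₂ h₂
      · exact hGm hst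
      · calc G s ≤ G (a R) := hGm.monotone h₁
          _ = h (a R) := by rw [hGR, hhR]
          _ < h t := hhm (not_le.1 h₂)
      · exact absurd (hst.le.trans h₂) h₁
      · exact hhm hst
    · intro i hi
      rcases Nat.lt_or_ge R i with h' | h'
      · obtain rfl : i = R + 1 := by omega
        simp only
        rw [if_neg (not_le.2 hlt), hhR']
      · simp only
        rw [if_pos (hle i h'), hGab i h']
    · intro i hi t ht
      simp only
      rcases Nat.lt_or_ge i R with h' | h'
      · rw [if_pos (ht.2.trans (hle (i + 1) h')), hG i h' t ht]
      · obtain rfl : i = R := by omega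
        split_ifs with h''
        · obtain rfl : t = a i := le_antisymm h'' ht.1
          rw [hGR]
          ring
        · exact hh t

/-- An increasing homeomorphism from `[p, p + 1]` onto `[q, q + 1]` extends to the lift of an
orientation-preserving circle homeomorphism. -/
lemma exists_isOPLift_eqOn {G : ℝ → ℝ} (hc : Continuous G) (hm : StrictMono G) {p : ℝ}
    (hG : G (p + 1) = G p + 1) :
    ∃ g G', IsOPLift g G' ∧ EqOn G' G (Icc p (p + 1)) := by
  set G' : ℝ → ℝ := fun t => G (t - ⌊t - p⌋) + ⌊t - p⌋ with hG'
  have hper : ∀ t, G' (t + 1) = G' t + 1 := by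
    intro t
    have : ⌊t + 1 - p⌋ = ⌊t - p⌋ + 1 := by
      rw [show t + 1 - p = t - p + 1 by ring, Int.floor_add_one]
    simp only [hG', this]
    push_cast
    rw [show t + 1 - (⌊t - p⌋ + 1 : ℝ) = t - ⌊t - p⌋ by ring]
    ring
  have heq : EqOn G' G (Ico p (p + 1)) := by
    intro t ht
    have : ⌊t - p⌋ = 0 := Int.floor_eq_zero_iff.2 ⟨by linarith [ht.1], by linarith [ht.2]⟩
    simp [hG', this]
  have hmono : StrictMono G' := by
    intro s t hst
    rcases (Int.floor_mono (by linarith : s - p ≤ t - p)).eq_or_lt with h | h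
    · simp only [hG', h]
      gcongr
      exact hm (by linarith)
    · have h' : (⌊s - p⌋ : ℝ) + 1 ≤ ⌊t - p⌋ := by exact_mod_cast h
      have h₁ := hm (show s - ⌊s - p⌋ < p + 1 by linarith [Int.lt_floor_add_one (s - p)])
      have h₂ := hm.monotone (show p ≤ t - ⌊t - p⌋ by linarith [Int.floor_le (t - p)])
      simp only [hG']
      linarith
  have hsurj : Function.Surjective G' := by
    intro y
    have h₁ := Int.floor_le (y - G p)
    have h₂ := Int.lt_floor_add_one (y - G p)
    obtain ⟨t, ht, hty⟩ := intermediate_value_Ico (by linarith : p ≤ p + 1) hc.continuousOn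
      (show y - ⌊y - G p⌋ ∈ Ico (G p) (G (p + 1)) from ⟨by linarith, by linarith⟩)
    have hfl : ⌊t + ⌊y - G p⌋ - p⌋ = ⌊y - G p⌋ := by
      rw [Int.floor_eq_iff]
      exact ⟨by linarith [ht.1], by linarith [ht.2]⟩
    refine ⟨t + ⌊y - G p⌋, ?_⟩
    simp only [hG', hfl, add_sub_cancel_right, hty, sub_add_cancel]
  have hcirc : Function.Periodic (fun t => ((G' t : ℝ) : UnitAddCircle)) 1 := by
    intro t
    simp only
    rw [hper, UnitAddCircle.coe_eq_coe_iff]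
    exact ⟨-1, by push_cast; ring⟩
  refine ⟨hcirc.lift, G', ⟨hmono.monotone.continuous_of_surjective hsurj, hmono, hper,
    fun t => hcirc.lift_coe t⟩, fun t ht => ?_⟩
  rcases ht.2.eq_or_lt with rfl | h
  · rw [hper, heq ⟨le_rfl, by linarith⟩, hG]
  · exact heq ⟨ht.1, h⟩

lemma IsOPLift.image_coe_image_Icc {g : UnitAddCircle → UnitAddCircle} {G : ℝ → ℝ}
    (hg : IsOPLift g G) {p q : ℝ} (hpq : p ≤ q) :
    g '' ((fun t : ℝ => (t : UnitAddCircle)) '' Icc p q) =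
      (fun t : ℝ => (t : UnitAddCircle)) '' Icc (G p) (G q) := by
  have h : G '' Icc p q = Icc (G p) (G q) :=
    (hg.2.1.monotone.mapsTo_Icc.image_subset).antisymm
      (intermediate_value_Icc hpq hg.1.continuousOn)
  rw [← h, image_image, image_image]
  exact image_congr fun t _ => hg.2.2.2 t

/-- Two dyadic chains of the same length, each going once around the circle, define an element
of the Thompson group. -/
lemma exists_inThompsonGroup_of_chains (hF : IsLiftDeg2 φ F) {R : ℕ} (hR : 0 < R)
    {a b : ℕ → ℝ} {n m : ℕ → ℕ} (ha : IsDyadicChain F R a n) (hb : IsDyadicChain F R b m)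
    (ha1 : a R = a 0 + 1) (hb1 : b R = b 0 + 1) :
    ∃ g G, InThompsonGroup φ F g ∧ IsOPLift g G ∧ ∀ i < R, ∀ t ∈ Icc (a i) (a (i + 1)),
      F^[m i] (G t) = F^[n i] t - F^[n i] (a i) + F^[m i] (b i) := by
  obtain ⟨G₀, hc, hm, hab, hG₀⟩ := exists_chain_map hF ha hb
  obtain ⟨g, G, hg, hG⟩ := exists_isOPLift_eqOn (p := a 0) hc hm
    (by rw [← ha1, hab R le_rfl, hab 0 hR.le, hb1])
  have hamono : ∀ i j : ℕ, i ≤ j → j ≤ R → a i ≤ a j := fun i j hij hj =>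
    (ha.strictMonoOn hF).monotoneOn (mem_Iic.2 (hij.trans hj)) (mem_Iic.2 hj) hij
  have hmem : ∀ i ≤ R, a i ∈ Icc (a 0) (a 0 + 1) := fun i hi =>
    ⟨hamono 0 i (Nat.zero_le i) hi, ha1 ▸ hamono i R hi le_rfl⟩
  have hGab : ∀ i ≤ R, G (a i) = b i := fun i hi => by rw [hG (hmem i hi), hab i hi]
  have hrel : ∀ i < R, ∀ t ∈ Icc (a i) (a (i + 1)),
      F^[m i] (G t) = F^[n i] t - F^[n i] (a i) + F^[m i] (b i) := fun i hi t ht => by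
    rw [hG ⟨(hmem i hi.le).1.trans ht.1, ht.2.trans (hmem (i + 1) hi).2⟩, hG₀ i hi t ht]
  refine ⟨g, G, ⟨⟨G, hg⟩, R,
    fun i => (fun t : ℝ => (t : UnitAddCircle)) '' Icc (a i) (a (i + 1)),
    fun i => (fun t : ℝ => (t : UnitAddCircle)) '' Icc (b i) (b (i + 1)),
    fun i => n i, fun i => m i, hR,
    fun i => (ha i i.2).isDyadic hF, fun i => (hb i i.2).isDyadic hF,
    iUnion_coe_image_Icc ha1, iUnion_coe_image_Icc hb1,
    pairwise_interior_coe_image_Icc (ha.strictMonoOn hF) ha1,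
    pairwise_interior_coe_image_Icc (hb.strictMonoOn hF) hb1, fun i => ?_, ?_⟩, hg, hrel⟩
  · rw [hg.image_coe_image_Icc ((ha i i.2).lt hF).le, hGab i i.2.le, hGab (i + 1) i.2]
  · rintro i _ ⟨t, ht, rfl⟩
    obtain ⟨k, hk⟩ := (ha i i.2).1
    obtain ⟨l, hl⟩ := (hb i i.2).1
    simp only
    rw [hg.2.2.2, hF.iterate_coe_s18, hF.iterate_coe_s18, hrel i i.2 t ht,
      UnitAddCircle.coe_eq_coe_iff, hk, hl]
    exact ⟨k - l, by push_cast; ring⟩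

end Thompson

/-- every iterate `φ^k` coincides locally, around any point, with an
element of the Thompson group `T_φ`. -/
theorem iterate_locally_in_thompson
    (φ : UnitAddCircle → UnitAddCircle) (F : ℝ → ℝ)
    (hF : IsLiftDeg2 φ F) (h0 : φ 0 = 0) :
    ∀ (x : UnitAddCircle) (k : ℕ), 1 ≤ k →
      ∃ (g : UnitAddCircle → UnitAddCircle) (U : Set UnitAddCircle),
        InThompsonGroup φ F g ∧ IsOpen U ∧ x ∈ U ∧ ∀ y ∈ U, g y = φ^[k] y := by
  intro x k _
  obtain ⟨x, rfl⟩ := QuotientAddGroup.mk_surjective x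
  choose a ha using fun i : ℕ => hF.surjective_iterate (2 + k) (⌊F^[2 + k] x⌋ - 1 + i)
  have hF2 : ∀ t, F^[2] (F^[k] t) = F^[2 + k] t := fun t =>
    (Function.iterate_add_apply F 2 k t).symm
  have hmono : ∀ i j, i < j → a i < a j := fun i j hij => by
    rw [← (hF.strictMono_iterate (2 + k)).lt_iff_lt, ha, ha]
    gcongr
  have haseg : ∀ i, IsDyadicSegment F (2 + k) (a i) (a (i + 1)) := fun i =>
    ⟨⟨⌊F^[2 + k] x⌋ - 1 + i, by rw [ha]; push_cast; rfl⟩, by rw [ha, ha]; push_cast; ring⟩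
  have hbseg : ∀ i, IsDyadicSegment F 2 (F^[k] (a i)) (F^[k] (a (i + 1))) := fun i => by
    simpa only [IsDyadicSegment, hF2] using haseg i
  have ha1 : a (2 ^ (2 + k)) = a 0 + 1 := by
    refine (hF.strictMono_iterate (2 + k)).injective ?_
    rw [hF.iterate_add_one_s18, ha, ha]
    push_cast
    ring
  have hb4 : F^[k] (a 4) = F^[k] (a 0) + 1 := by
    refine (hF.strictMono_iterate 2).injective ?_
    rw [hF.iterate_add_one_s18, hF2, hF2, ha, ha]
    norm_num
  obtain ⟨M, hM⟩ : ∃ M, 2 ^ (2 + k) = M + 1 + 1 + 1 + 1 := by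
    have : 4 ≤ 2 ^ (2 + k) := by
      rw [pow_add]
      have := Nat.one_le_two_pow (n := k)
      omega
    exact ⟨2 ^ (2 + k) - 4, by omega⟩
  -- the first three segments of the target have degree two, the fourth one is subdivided
  obtain ⟨c, m, hc0, hcM, hc⟩ := (hbseg 3).exists_chain hF h0 M
  have hb := ((hc.prepend (hc0 ▸ hbseg 2)).prepend (p := F^[k] (a 1)) (hbseg 1)).prepend
    (p := F^[k] (a 0)) (hbseg 0)
  rw [← hM] at hb
  obtain ⟨g, G, hgT, hg, hG⟩ := exists_inThompsonGroup_of_chains hF (by positivity)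
    (fun i _ => haseg i : IsDyadicChain F (2 ^ (2 + k)) a fun _ => 2 + k) hb ha1
    (by rw [hM]; exact hcM.trans hb4)
  have hGF : ∀ t ∈ Ioo (a 0) (a 2), G t = F^[k] t := by
    intro t ht
    refine (hF.strictMono_iterate 2).injective ?_
    rcases le_total t (a 1) with h | h
    · have h' : F^[2] (G t) = F^[2 + k] t - F^[2 + k] (a 0) + F^[2] (F^[k] (a 0)) :=
        hG 0 (by omega) t ⟨ht.1.le, h⟩
      rw [h', hF2, hF2]
      ring
    · have h' : F^[2] (G t) = F^[2 + k] t - F^[2 + k] (a 1) + F^[2] (F^[k] (a 1)) :=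
        hG 1 (by omega) t ⟨h, ht.2.le⟩
      rw [h', hF2, hF2]
      ring
  refine ⟨g, (fun t : ℝ => (t : UnitAddCircle)) '' Ioo (a 0) (a 2), hgT,
    QuotientAddGroup.isOpenMap_coe _ isOpen_Ioo, ⟨x, ⟨?_, ?_⟩, rfl⟩, ?_⟩
  · rw [← (hF.strictMono_iterate (2 + k)).lt_iff_lt, ha]
    push_cast
    linarith [Int.floor_le (F^[2 + k] x)]
  · rw [← (hF.strictMono_iterate (2 + k)).lt_iff_lt, ha]
    push_cast
    linarith [Int.lt_floor_add_one (F^[2 + k] x)]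
  · rintro _ ⟨t, ht, rfl⟩
    simp only
    rw [hg.2.2.2, hF.iterate_coe_s18, hGF t ht]
end
end
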